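/- arXiv:2311.12618 — 2 statements merged into one kernel-verified Lean document; each statement's English description precedes it below -/
import Mathlib

section
/- For every α > 0 there exists a constant c > 0 such that for every even N ≥ 2 the following holds. Let 𝓜 be any family of perfect matchings on the vertex set Fin N that is pairwise edge-disjoint and satisfies |𝓜| ≥ α·N. Let μ be the uniform distribution on {0,1}^N × 𝓜. Then every deterministic one-way protocol for the Hidden Matching problem, given by an encoding enc : {0,1}^N → {0,1}^m and a decoding dec : {0,1}^m × 𝓜 → Fin N × Fin N × 𝔽₂, that is correct on at least a 7/8-fraction of inputs (f, M) under μ — correctness on (f, M) meaning that dec(enc(f), M) = (i, j, b) with {i, j} an edge of M and b = f_i + f_j — must satisfy m ≥ c·√N. -/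
/-- A perfect matching on the vertex set `Fin N`: a set of non-diagonal unordered pairs
(edges) such that every vertex lies in exactly one edge. -/
def IsPerfectMatchingOn {N : ℕ} (M : Finset (Sym2 (Fin N))) : Prop :=
  (∀ e ∈ M, ¬ e.IsDiag) ∧ ∀ v : Fin N, ∃! e, e ∈ M ∧ v ∈ e

/-- Sign of the parity check: `1` if `b = f i + f j`, else `-1`. -/
noncomputable def hmSg {N : ℕ} (b : ZMod 2) (i j : Fin N) (f : Fin N → ZMod 2) : ℝ :=
  if b = f i + f j then 1 else -1

lemma hm_zmod_aux (a b c : ZMod 2) : (a = b + 1 + c) ↔ ¬ (a = b + c) := by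
  revert a b c; decide

lemma hmSg_flip_left {N : ℕ} (b : ZMod 2) (i j : Fin N) (h : i ≠ j) (f : Fin N → ZMod 2) :
    hmSg b i j (f + Pi.single i 1) = - hmSg b i j f := by
  have h1 : (f + Pi.single i 1 : Fin N → ZMod 2) i = f i + 1 := by simp
  have h2 : (f + Pi.single i 1 : Fin N → ZMod 2) j = f j := by simp [h.symm]
  unfold hmSg
  rw [h1, h2]
  by_cases hb : b = f i + f j
  · rw [if_neg (by rw [hm_zmod_aux]; simpa using hb), if_pos hb]
  · rw [if_pos (by rw [hm_zmod_aux]; exact hb), if_neg hb]; simp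

lemma hmSg_comm {N : ℕ} (b : ZMod 2) (i j : Fin N) (f : Fin N → ZMod 2) :
    hmSg b i j f = hmSg b j i f := by
  unfold hmSg; rw [add_comm]

lemma hmSg_flip {N : ℕ} (b : ZMod 2) (i j v : Fin N) (h : i ≠ j) (hv : v = i ∨ v = j)
    (f : Fin N → ZMod 2) :
    hmSg b i j (f + Pi.single v 1) = - hmSg b i j f := by
  rcases hv with rfl | rfl
  · exact hmSg_flip_left b _ _ h f
  · rw [hmSg_comm b i, hmSg_comm b i]; exact hmSg_flip_left b _ _ h.symm f

lemma hmSg_flip_other {N : ℕ} (b : ZMod 2) (i j v : Fin N) (hi : i ≠ v) (hj : j ≠ v)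
    (f : Fin N → ZMod 2) :
    hmSg b i j (f + Pi.single v 1) = hmSg b i j f := by
  unfold hmSg; simp [hi, hj]

lemma hmSg_cases {N : ℕ} (b : ZMod 2) (i j : Fin N) (f : Fin N → ZMod 2) :
    hmSg b i j f = 1 ∨ hmSg b i j f = -1 := by
  unfold hmSg; split_ifs <;> simp

lemma hm_sum_flip {N : ℕ} (v : Fin N) (H : (Fin N → ZMod 2) → ℝ) :
    ∑ f : Fin N → ZMod 2, H (f + Pi.single v 1) = ∑ f : Fin N → ZMod 2, H f :=
  Equiv.sum_comp (Equiv.addRight (Pi.single v 1 : Fin N → ZMod 2)) H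

/-- Sets of edges that can be built by adding edges with a fresh endpoint. -/
inductive HmPeel {N : ℕ} {ι : Type} [DecidableEq ι] (i j : ι → Fin N) : Finset ι → Prop
  | empty : HmPeel i j ∅
  | insert (F : Finset ι) (e : ι) (v : Fin N) : HmPeel i j F → e ∉ F → i e ≠ j e →
      (v = i e ∨ v = j e) → (∀ a ∈ F, i a ≠ v ∧ j a ≠ v) → HmPeel i j (insert e F)

lemma hm_mgf {N : ℕ} {ι : Type} [DecidableEq ι] (i j : ι → Fin N) (b : ι → ZMod 2) (θ : ℝ)
    (F : Finset ι) (hF : HmPeel i j F) :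
    ∑ f : Fin N → ZMod 2, Real.exp (θ * ∑ e ∈ F, hmSg (b e) (i e) (j e) f)
      = 2 ^ N * Real.cosh θ ^ F.card := by
  induction hF with
  | empty => simp [ZMod.card]
  | insert F e v hF he hij hv hfresh ih =>
    rw [Finset.card_insert_of_notMem he, pow_succ, ← mul_assoc, ← ih]
    set G : (Fin N → ZMod 2) → ℝ := fun f => ∑ e ∈ F, hmSg (b e) (i e) (j e) f with hG
    have hGv : ∀ f, G (f + Pi.single v 1) = G f := by
      intro f
      apply Finset.sum_congr rfl
      intro a ha
      exact hmSg_flip_other _ _ _ _ (hfresh a ha).1 (hfresh a ha).2 f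
    have h1 : ∀ f, ∑ a ∈ insert e F, hmSg (b a) (i a) (j a) f
        = hmSg (b e) (i e) (j e) f + G f := by
      intro f; rw [Finset.sum_insert he]
    simp only [h1]
    set H : (Fin N → ZMod 2) → ℝ :=
      fun f => Real.exp (θ * (hmSg (b e) (i e) (j e) f + G f)) with hH
    have h2 : ∑ f : Fin N → ZMod 2, H f + ∑ f : Fin N → ZMod 2, H (f + Pi.single v 1)
        = 2 * ((∑ f, Real.exp (θ * G f)) * Real.cosh θ) := by
      rw [← Finset.sum_add_distrib, Finset.sum_mul, Finset.mul_sum]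
      apply Finset.sum_congr rfl
      intro f _
      simp only [hH, hGv, hmSg_flip (b e) (i e) (j e) v hij hv f]
      rw [Real.cosh_eq]
      rcases hmSg_cases (b e) (i e) (j e) f with h | h <;> rw [h] <;>
        simp only [mul_add, Real.exp_add, mul_one, mul_neg, neg_neg] <;> ring
    rw [hm_sum_flip v H] at h2
    change ∑ f, H f = _
    linarith

lemma hm_exists_peel {N : ℕ} {ι : Type} [DecidableEq ι] (i j : ι → Fin N) (E : Finset ι)
    (hne : ∀ e ∈ E, i e ≠ j e)
    (hinj : ∀ a ∈ E, ∀ c ∈ E, s(i a, j a) = s(i c, j c) → a = c) (s : ℕ) :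
    2 * s ^ 2 < E.card → ∃ F ⊆ E, HmPeel i j F ∧ F.card = s := by
  induction s with
  | zero => intro _; exact ⟨∅, by simp, HmPeel.empty, rfl⟩
  | succ s ih =>
    intro h
    obtain ⟨F, hFE, hF, hc⟩ := ih (lt_of_le_of_lt (by gcongr; omega) h)
    set V := F.image i ∪ F.image j with hV
    have hVc : V.card ≤ 2 * s := by
      refine (Finset.card_union_le _ _).trans ?_
      have := Finset.card_image_le (s := F) (f := i)
      have := Finset.card_image_le (s := F) (f := j)
      omega
    have hex : ∃ e ∈ E, ∃ v, (v = i e ∨ v = j e) ∧ v ∉ V := by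
      by_contra hcon
      push Not at hcon
      have hle : E.card ≤ V.sym2.card := by
        apply Finset.card_le_card_of_injOn (fun e => s(i e, j e))
        · intro e he
          simp only [Finset.mem_coe, Finset.mk_mem_sym2_iff]
          exact ⟨hcon e he _ (Or.inl rfl), hcon e he _ (Or.inr rfl)⟩
        · intro a ha c hc' hac
          exact hinj a ha c hc' hac
      rw [Finset.card_sym2] at hle
      have h2 : (V.card + 1).choose 2 ≤ (2 * s + 1).choose 2 :=
        Nat.choose_le_choose 2 (by omega)
      have h3 : (2 * s + 1).choose 2 = s * (2 * s + 1) := by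
        rw [Nat.choose_two_right]
        have : (2 * s + 1) * (2 * s + 1 - 1) = 2 * (s * (2 * s + 1)) := by
          rw [Nat.add_sub_cancel]; ring
        rw [this]; omega
      nlinarith
    obtain ⟨e, he, v, hv, hvV⟩ := hex
    have hfresh : ∀ a ∈ F, i a ≠ v ∧ j a ≠ v := by
      intro a ha
      constructor
      · rintro rfl; exact hvV (Finset.mem_union_left _ (Finset.mem_image_of_mem _ ha))
      · rintro rfl; exact hvV (Finset.mem_union_right _ (Finset.mem_image_of_mem _ ha))
    have heF : e ∉ F := by
      intro h'
      rcases hv with rfl | rfl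
      · exact (hfresh e h').1 rfl
      · exact (hfresh e h').2 rfl
    exact ⟨insert e F, Finset.insert_subset he hFE,
      HmPeel.insert F e v hF heF (hne e he) hv hfresh,
      by rw [Finset.card_insert_of_notMem heF, hc]⟩

lemma hm_peel_tail {N : ℕ} {ι : Type} [DecidableEq ι] (i j : ι → Fin N) (b : ι → ZMod 2)
    (F : Finset ι) (hF : HmPeel i j F) :
    ((Finset.univ.filter fun f : Fin N → ZMod 2 =>
      (F.card : ℝ) / 4 ≤ ∑ e ∈ F, hmSg (b e) (i e) (j e) f).card : ℝ)
      ≤ 2 ^ N * Real.exp (-(F.card : ℝ) / 32) := by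
  have h := hm_mgf i j b (1 / 4) F hF
  have hcosh : Real.cosh (1 / 4) ^ F.card ≤ Real.exp ((F.card : ℝ) / 32) := by
    calc Real.cosh (1 / 4) ^ F.card ≤ (Real.exp ((1 / 4) ^ 2 / 2)) ^ F.card := by
          gcongr
          exact Real.cosh_le_exp_half_sq _
      _ = Real.exp ((F.card : ℝ) / 32) := by
          rw [← Real.exp_nat_mul]; congr 1; ring
  set S := (Finset.univ.filter fun f : Fin N → ZMod 2 =>
      (F.card : ℝ) / 4 ≤ ∑ e ∈ F, hmSg (b e) (i e) (j e) f) with hS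
  have h1 : (S.card : ℝ) * Real.exp ((F.card : ℝ) / 16) ≤
      ∑ f : Fin N → ZMod 2, Real.exp (1 / 4 * ∑ e ∈ F, hmSg (b e) (i e) (j e) f) := by
    calc (S.card : ℝ) * Real.exp ((F.card : ℝ) / 16)
        = ∑ f ∈ S, Real.exp ((F.card : ℝ) / 16) := by simp
      _ ≤ ∑ f ∈ S, Real.exp (1 / 4 * ∑ e ∈ F, hmSg (b e) (i e) (j e) f) := by
          apply Finset.sum_le_sum
          intro f hf
          have := (Finset.mem_filter.mp hf).2
          apply Real.exp_le_exp.mpr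
          linarith
      _ ≤ _ := Finset.sum_le_sum_of_subset_of_nonneg (Finset.subset_univ _)
          (fun _ _ _ => (Real.exp_pos _).le)
  rw [h] at h1
  have h2 : (S.card : ℝ) * Real.exp ((F.card : ℝ) / 16) ≤
      2 ^ N * Real.exp (-(F.card : ℝ) / 32) * Real.exp ((F.card : ℝ) / 16) := by
    rw [mul_assoc, ← Real.exp_add]
    refine h1.trans ?_
    have : -(F.card : ℝ) / 32 + (F.card : ℝ) / 16 = (F.card : ℝ) / 32 := by ring
    rw [this]
    gcongr
  exact le_of_mul_le_mul_right h2 (Real.exp_pos _)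

lemma hm_tail {N : ℕ} {ι : Type} [DecidableEq ι] (i j : ι → Fin N) (b : ι → ZMod 2)
    (s : ℕ) (hs : 1 ≤ s) (n : ℕ) : ∀ (E : Finset ι), E.card ≤ n →
    (∀ e ∈ E, i e ≠ j e) →
    (∀ a ∈ E, ∀ c ∈ E, s(i a, j a) = s(i c, j c) → a = c) →
    ((Finset.univ.filter fun f : Fin N → ZMod 2 =>
      2 * (s : ℝ) ^ 2 + (E.card : ℝ) / 4 < ∑ e ∈ E, hmSg (b e) (i e) (j e) f).card : ℝ)
      ≤ n * (2 ^ N * Real.exp (-(s : ℝ) / 32)) := by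
  induction n with
  | zero =>
    intro E hE _ _
    have : E = ∅ := by simpa using hE
    subst this
    simp
  | succ n ih =>
    intro E hE hne hinj
    by_cases hbig : 2 * s ^ 2 < E.card
    · obtain ⟨F, hFE, hF, hFc⟩ := hm_exists_peel i j E hne hinj s hbig
      have hcard : (E \ F).card = E.card - s := by
        rw [Finset.card_sdiff_of_subset hFE, hFc]
      have hsE : s ≤ E.card := hFc ▸ Finset.card_le_card hFE
      have hcardR : ((E \ F).card : ℝ) = E.card - s := by
        rw [hcard, Nat.cast_sub hsE]
      have h1 := ih (E \ F) (by omega)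
        (fun e he => hne e (Finset.sdiff_subset he))
        (fun a ha c hc => hinj a (Finset.sdiff_subset ha) c (Finset.sdiff_subset hc))
      have h2 := hm_peel_tail i j b F hF
      rw [hFc] at h2
      have h3 : (Finset.univ.filter fun f : Fin N → ZMod 2 =>
          2 * (s : ℝ) ^ 2 + (E.card : ℝ) / 4 < ∑ e ∈ E, hmSg (b e) (i e) (j e) f) ⊆
          (Finset.univ.filter fun f : Fin N → ZMod 2 =>
            (s : ℝ) / 4 ≤ ∑ e ∈ F, hmSg (b e) (i e) (j e) f) ∪
          (Finset.univ.filter fun f : Fin N → ZMod 2 =>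
            2 * (s : ℝ) ^ 2 + ((E \ F).card : ℝ) / 4
              < ∑ e ∈ E \ F, hmSg (b e) (i e) (j e) f) := by
        intro f hf
        have hf' := (Finset.mem_filter.mp hf).2
        rw [← Finset.sum_sdiff hFE] at hf'
        simp only [Finset.mem_union, Finset.mem_filter, Finset.mem_univ, true_and]
        by_contra hcon
        push Not at hcon
        rw [hcardR] at hcon
        linarith [hcon.1, hcon.2]
      have h4 := (Finset.card_le_card h3).trans (Finset.card_union_le _ _)
      have h5 := (Nat.cast_le (α := ℝ)).mpr h4
      push_cast at h5 ⊢
      linarith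
    · have hempty : (Finset.univ.filter fun f : Fin N → ZMod 2 =>
          2 * (s : ℝ) ^ 2 + (E.card : ℝ) / 4 < ∑ e ∈ E, hmSg (b e) (i e) (j e) f) = ∅ := by
        apply Finset.filter_eq_empty_iff.mpr
        intro f _
        have hle : ∑ e ∈ E, hmSg (b e) (i e) (j e) f ≤ ∑ e ∈ E, (1 : ℝ) := by
          apply Finset.sum_le_sum
          intro e _
          rcases hmSg_cases (b e) (i e) (j e) f with h | h <;> rw [h] <;> norm_num
        have hb : (E.card : ℝ) ≤ 2 * (s : ℝ) ^ 2 := by exact_mod_cast not_lt.mp hbig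
        have : (0 : ℝ) ≤ E.card := by positivity
        simp at hle
        linarith
      rw [hempty]
      simp only [Finset.card_empty, Nat.cast_zero]
      positivity

/-- A single check is satisfied by at most half of the inputs. -/
lemma hm_half {N : ℕ} (b : ZMod 2) (i j : Fin N) (h : i ≠ j) :
    ((Finset.univ.filter fun f : Fin N → ZMod 2 => b = f i + f j).card : ℝ) = 2 ^ N / 2 := by
  have h0 := hm_sum_flip i (hmSg b i j)
  simp only [hmSg_flip_left b i j h, Finset.sum_neg_distrib] at h0
  have h1 : ∑ f, hmSg b i j f = 0 := by linarith
  have h2 : ∀ f : Fin N → ZMod 2, hmSg b i j f = 2 * (if b = f i + f j then 1 else 0) - 1 := by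
    intro f; unfold hmSg; split_ifs <;> norm_num
  simp only [h2, Finset.sum_sub_distrib, ← Finset.mul_sum, Finset.sum_boole] at h1
  simp [ZMod.card] at h1
  linarith

/-- Main counting bound. -/
lemma hm_main {N : ℕ} (𝓜 : Finset (Finset (Sym2 (Fin N))))
    (hpm : ∀ M ∈ 𝓜, IsPerfectMatchingOn M)
    (hdis : ∀ M₁ ∈ 𝓜, ∀ M₂ ∈ 𝓜, M₁ ≠ M₂ → Disjoint M₁ M₂)
    (hpos : 0 < 𝓜.card) (m : ℕ)
    (enc : (Fin N → ZMod 2) → (Fin m → ZMod 2))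
    (dec : (Fin m → ZMod 2) → Finset (Sym2 (Fin N)) → Fin N × Fin N × ZMod 2)
    (hcor : (7 / 8 : ℝ) * ((2 : ℝ) ^ N * (𝓜.card : ℝ)) ≤
              (((Finset.univ ×ˢ 𝓜).filter
                  fun p : (Fin N → ZMod 2) × Finset (Sym2 (Fin N)) =>
                    s((dec (enc p.1) p.2).1, (dec (enc p.1) p.2).2.1) ∈ p.2 ∧
                      (dec (enc p.1) p.2).2.2 =
                        p.1 (dec (enc p.1) p.2).1 +
                          p.1 (dec (enc p.1) p.2).2.1).card : ℝ)) :
    1 ≤ m ∧ ∀ s : ℕ, 1 ≤ s → 8 * s ^ 2 < 𝓜.card →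
      Real.exp ((s : ℝ) / 32) ≤ 2 ^ (m + 1) * 𝓜.card := by
  classical
  set K : ℝ := (𝓜.card : ℝ) with hK
  have hKpos : 0 < K := by rw [hK]; exact_mod_cast hpos
  set P : (Fin m → ZMod 2) → (Fin N → ZMod 2) → Finset (Sym2 (Fin N)) → Prop :=
    fun y f M => s((dec y M).1, (dec y M).2.1) ∈ M ∧
      (dec y M).2.2 = f (dec y M).1 + f (dec y M).2.1 with hP
  have hsum : (((Finset.univ ×ˢ 𝓜).filter
                  fun p : (Fin N → ZMod 2) × Finset (Sym2 (Fin N)) =>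
                    s((dec (enc p.1) p.2).1, (dec (enc p.1) p.2).2.1) ∈ p.2 ∧
                      (dec (enc p.1) p.2).2.2 =
                        p.1 (dec (enc p.1) p.2).1 +
                          p.1 (dec (enc p.1) p.2).2.1).card : ℝ)
      = ∑ f : Fin N → ZMod 2, ∑ M ∈ 𝓜, if P (enc f) f M then (1 : ℝ) else 0 := by
    rw [← Finset.sum_product', ← Finset.sum_boole]
  rw [hsum] at hcor
  have hne : ∀ y, ∀ M ∈ 𝓜, s((dec y M).1, (dec y M).2.1) ∈ M →
      (dec y M).1 ≠ (dec y M).2.1 := by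
    intro y M hM he heq
    exact (hpm M hM).1 _ he (by simpa using heq)
  constructor
  · by_contra hm
    have hm0 : m = 0 := by omega
    subst hm0
    have hsub : ∀ f, enc f = 0 := fun f => Subsingleton.elim _ _
    simp only [hsub] at hcor
    rw [Finset.sum_comm] at hcor
    have : ∑ M ∈ 𝓜, ∑ f : Fin N → ZMod 2, (if P 0 f M then (1 : ℝ) else 0) ≤
        ∑ M ∈ 𝓜, (2 ^ N / 2 : ℝ) := by
      apply Finset.sum_le_sum
      intro M hM
      by_cases hv : s((dec 0 M).1, (dec 0 M).2.1) ∈ M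
      · rw [← hm_half (dec 0 M).2.2 _ _ (hne 0 M hM hv), Finset.sum_boole]
        simp only [hP, hv, true_and, le_refl]
      · simp only [hP, hv, false_and, if_false, Finset.sum_const_zero]
        positivity
    rw [Finset.sum_const, nsmul_eq_mul] at this
    have h2 : (0 : ℝ) < 2 ^ N * K := by positivity
    rw [← hK] at this
    nlinarith
  · intro s hs hsK
    have hsK' : 8 * (s : ℝ) ^ 2 < K := by rw [hK]; exact_mod_cast hsK
    set c : (Fin N → ZMod 2) → ℝ := fun f => ∑ M ∈ 𝓜, if P (enc f) f M then (1 : ℝ) else 0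
      with hc
    set G := Finset.univ.filter fun f : Fin N → ZMod 2 => 3 / 4 * K ≤ c f with hG
    have hcK : ∀ f, c f ≤ K := by
      intro f
      calc c f ≤ ∑ M ∈ 𝓜, (1 : ℝ) := by
            apply Finset.sum_le_sum; intro M _; split_ifs <;> norm_num
        _ = K := by simp [hK]
    have hGcard : (2 : ℝ) ^ N / 2 ≤ G.card := by
      have h1 : ∑ f, c f ≤ ∑ f : Fin N → ZMod 2,
          (3 / 4 * K + K / 4 * (if 3 / 4 * K ≤ c f then 1 else 0)) := by
        apply Finset.sum_le_sum
        intro f _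
        split_ifs with h
        · linarith [hcK f]
        · linarith
      rw [Finset.sum_add_distrib, ← Finset.mul_sum Finset.univ _ (K / 4), Finset.sum_boole] at h1
      simp only [Finset.sum_const, Finset.card_univ, Fintype.card_fun, ZMod.card,
        Fintype.card_fin, nsmul_eq_mul, Nat.cast_pow, Nat.cast_ofNat] at h1
      have h2 : 7 / 8 * (2 ^ N * K) ≤ 2 ^ N * (3 / 4 * K) + K / 4 * (G.card : ℝ) :=
        hcor.trans h1
      have h3 : K * (2 ^ N / 2) ≤ K * (G.card : ℝ) := by linarith
      exact le_of_mul_le_mul_left h3 hKpos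
    -- bad sets
    set E : (Fin m → ZMod 2) → Finset (Finset (Sym2 (Fin N))) := fun y =>
      𝓜.filter fun M => s((dec y M).1, (dec y M).2.1) ∈ M with hE
    set B : (Fin m → ZMod 2) → Finset (Fin N → ZMod 2) := fun y =>
      Finset.univ.filter fun f : Fin N → ZMod 2 =>
        2 * (s : ℝ) ^ 2 + ((E y).card : ℝ) / 4 <
          ∑ M ∈ E y, hmSg (dec y M).2.2 (dec y M).1 (dec y M).2.1 f with hB
    have hEK : ∀ y, ((E y).card : ℝ) ≤ K := by
      intro y
      rw [hK]
      exact_mod_cast Finset.card_filter_le _ _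
    have hBcard : ∀ y, ((B y).card : ℝ) ≤ K * (2 ^ N * Real.exp (-(s : ℝ) / 32)) := by
      intro y
      refine hm_tail (fun M => (dec y M).1) (fun M => (dec y M).2.1) (fun M => (dec y M).2.2)
        s hs 𝓜.card (E y) (Finset.card_filter_le _ _) ?_ ?_
      · intro M hM
        exact hne y M (Finset.mem_filter.mp hM).1 (Finset.mem_filter.mp hM).2
      · intro M hM M' hM' heq
        by_contra hneq
        have hd := hdis M (Finset.mem_filter.mp hM).1 M' (Finset.mem_filter.mp hM').1 hneq
        have h2 := (Finset.mem_filter.mp hM').2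
        rw [← heq] at h2
        exact Finset.disjoint_left.mp hd (Finset.mem_filter.mp hM).2 h2
    have hsubset : G ⊆ Finset.univ.biUnion B := by
      intro f hf
      have hf' := (Finset.mem_filter.mp hf).2
      refine Finset.mem_biUnion.mpr ⟨enc f, Finset.mem_univ _, ?_⟩
      refine Finset.mem_filter.mpr ⟨Finset.mem_univ _, ?_⟩
      have hceq : c f = ∑ M ∈ E (enc f),
          if (dec (enc f) M).2.2 = f (dec (enc f) M).1 + f (dec (enc f) M).2.1
            then (1 : ℝ) else 0 := by
        rw [Finset.sum_filter]
        apply Finset.sum_congr rfl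
        intro M _
        simp only [hP]
        split_ifs <;> simp_all
      have hsg : ∑ M ∈ E (enc f),
          hmSg (dec (enc f) M).2.2 (dec (enc f) M).1 (dec (enc f) M).2.1 f
          = 2 * c f - (E (enc f)).card := by
        rw [hceq, Finset.mul_sum, Finset.card_eq_sum_ones, Nat.cast_sum,
          ← Finset.sum_sub_distrib]
        apply Finset.sum_congr rfl
        intro M _
        unfold hmSg
        split_ifs <;> norm_num
      rw [hsg]
      have := hEK (enc f)
      linarith
    have hfin : (G.card : ℝ) ≤ 2 ^ m * (K * (2 ^ N * Real.exp (-(s : ℝ) / 32))) := by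
      have h1 : (G.card : ℝ) ≤ ∑ y, ((B y).card : ℝ) := by
        exact_mod_cast (Finset.card_le_card hsubset).trans Finset.card_biUnion_le
      refine h1.trans ((Finset.sum_le_sum fun y _ => hBcard y).trans ?_)
      simp [ZMod.card]
    have h5 : (2 : ℝ) ^ N * 1 ≤ 2 ^ N * (2 ^ (m + 1) * K * Real.exp (-(s : ℝ) / 32)) := by
      rw [pow_succ]; linarith
    have h6 := le_of_mul_le_mul_left h5 (by positivity)
    have h7 : Real.exp (-(s : ℝ) / 32) * Real.exp ((s : ℝ) / 32) = 1 := by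
      rw [← Real.exp_add]; simp [neg_div]
    have h8 := mul_le_mul_of_nonneg_right h6 (Real.exp_pos ((s : ℝ) / 32)).le
    rw [mul_assoc, h7] at h8
    linarith

/-- **Classical one-way lower bound for the Hidden Matching problem** (Bar-Yossef,
Jayram, Kerenidis).  For every `α > 0` there is a constant `c > 0` such that for every
even `N ≥ 2` and every family `𝓜` of pairwise edge-disjoint perfect matchings on
`Fin N` with `|𝓜| ≥ α·N` the following holds: every deterministic one-way protocol
`(enc, dec)`, whose output `(i, j, b) = dec (enc f) M` satisfies `{i, j} ∈ M` and
`b = f i + f j` for at least a `7/8`-fraction of the pairs `(f, M)` under the uniform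
distribution on `{0,1}^N × 𝓜`, must satisfy `m ≥ c·√N`. -/
theorem hidden_matching_lower_bound (α : ℝ) (hα : 0 < α) :
    ∃ c : ℝ, 0 < c ∧
      ∀ N : ℕ, 2 ≤ N → Even N →
        ∀ 𝓜 : Finset (Finset (Sym2 (Fin N))),
          (∀ M ∈ 𝓜, IsPerfectMatchingOn M) →
          (∀ M₁ ∈ 𝓜, ∀ M₂ ∈ 𝓜, M₁ ≠ M₂ → Disjoint M₁ M₂) →
          α * (N : ℝ) ≤ (𝓜.card : ℝ) →
          ∀ m : ℕ,
            ∀ enc : (Fin N → ZMod 2) → (Fin m → ZMod 2),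
            ∀ dec : (Fin m → ZMod 2) → Finset (Sym2 (Fin N)) →
              Fin N × Fin N × ZMod 2,
            (7 / 8 : ℝ) * ((2 : ℝ) ^ N * (𝓜.card : ℝ)) ≤
              (((Finset.univ ×ˢ 𝓜).filter
                  fun p : (Fin N → ZMod 2) × Finset (Sym2 (Fin N)) =>
                    s((dec (enc p.1) p.2).1, (dec (enc p.1) p.2).2.1) ∈ p.2 ∧
                      (dec (enc p.1) p.2).2.2 =
                        p.1 (dec (enc p.1) p.2).1 +
                          p.1 (dec (enc p.1) p.2).2.1).card : ℝ) →
            c * Real.sqrt (N : ℝ) ≤ (m : ℝ) := by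
  refine ⟨Real.sqrt α / 200000, by positivity, ?_⟩
  intro N hN _ 𝓜 hpm hdis hcard m enc dec hcor
  have hNpos : (0 : ℝ) < N := by exact_mod_cast (by omega : 0 < N)
  have hKpos : (0 : ℝ) < 𝓜.card := lt_of_lt_of_le (by positivity) hcard
  obtain ⟨hm, hmain⟩ := hm_main 𝓜 hpm hdis (by exact_mod_cast hKpos) m enc dec hcor
  set K : ℝ := (𝓜.card : ℝ) with hK
  set r := Real.sqrt K with hr
  have hrpos : 0 < r := Real.sqrt_pos.mpr hKpos
  have hr2 : r ^ 2 = K := Real.sq_sqrt hKpos.le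
  have hmR : (1 : ℝ) ≤ m := by exact_mod_cast hm
  have hgoal : r ≤ 200000 * m := by
    by_cases hbig : r < 3
    · linarith
    push Not at hbig
    set s := ⌊r / 3⌋₊ with hs
    have hs1 : 1 ≤ s := by
      rw [hs]; apply Nat.le_floor; push_cast; linarith
    have hsle : (s : ℝ) ≤ r / 3 := Nat.floor_le (by positivity)
    have hslt : r / 3 < s + 1 := Nat.lt_floor_add_one _
    have hs8 : 8 * s ^ 2 < 𝓜.card := by
      have : 8 * (s : ℝ) ^ 2 < K := by
        have : (s : ℝ) ^ 2 ≤ (r / 3) ^ 2 := by gcongr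
        nlinarith
      rw [hK] at this
      exact_mod_cast this
    have h := hmain s hs1 hs8
    have h1 := Real.log_le_log (Real.exp_pos _) h
    rw [Real.log_exp, Real.log_mul (by positivity) hKpos.ne', Real.log_pow, ← hr2,
      Real.log_pow] at h1
    have h2 : Real.log r = Real.log (r / 384) + Real.log 384 := by
      rw [← Real.log_mul (by positivity) (by norm_num)]; congr 1; ring
    have h3 : Real.log (r / 384) ≤ r / 384 - 1 := Real.log_le_sub_one_of_pos (by positivity)
    have h4 : Real.log 384 ≤ 384 - 1 := Real.log_le_sub_one_of_pos (by norm_num)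
    have h5 : Real.log 2 ≤ 2 - 1 := Real.log_le_sub_one_of_pos (by norm_num)
    have h6 : ((m + 1 : ℕ) : ℝ) * Real.log 2 ≤ ((m + 1 : ℕ) : ℝ) * 1 := by
      gcongr; linarith
    push_cast at h1 h6
    linarith
  have hfin : Real.sqrt α * Real.sqrt N ≤ r := by
    rw [← Real.sqrt_mul hα.le]
    exact Real.sqrt_le_sqrt hcard
  have : Real.sqrt α / 200000 * Real.sqrt N = Real.sqrt α * Real.sqrt N / 200000 := by ring
  rw [this]
  linarith
end

section
/- There exists a constant c > 0 such that for every n ≥ 1, with N = 2^n, every deterministic one-way protocol for the XOR Hidden Matching problem — given by an encoding enc : {0,1}^N → {0,1}^m and a decoding dec : {0,1}^m × (𝔽₂ⁿ \ {0}) → 𝔽₂ⁿ × 𝔽₂ — whose output (y, b) = dec(enc(f), x) satisfies (y, b) ∈ R_f(x) for at least a 7/8-fraction of pairs (f, x) under the uniform distribution on {0,1}^N × (𝔽₂ⁿ \ {0}), must satisfy m ≥ c·√N. (This follows from the general Hidden Matching lower bound applied to the family of XOR matchings M_x = {{y, y+x} : y ∈ 𝔽₂ⁿ} for nonzero x, which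 are pairwise edge-disjoint perfect matchings with N − 1 ≥ N/2 members.) -/
/-- A function `f : 𝔽₂ⁿ → 𝔽₂` (identified with its truth table in `{0,1}^{2^n}`). -/
abbrev BoolFunc (n : ℕ) := (Fin n → ZMod 2) → ZMod 2

/-- `(y, b) ∈ R_f(x)`, i.e. `f(y) + f(y + x) = b`. -/
abbrev memRel {n : ℕ} (f : BoolFunc n) (x : Fin n → ZMod 2)
    (yb : (Fin n → ZMod 2) × ZMod 2) : Prop :=
  f yb.1 + f (yb.1 + x) = yb.2

/-- Outcome sign: `1` if the answer `D x` is correct for `f`, `-1` otherwise. -/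
noncomputable def outSign {n : ℕ}
    (D : {x : Fin n → ZMod 2 // x ≠ 0} → (Fin n → ZMod 2) × ZMod 2)
    (x : {x : Fin n → ZMod 2 // x ≠ 0}) (f : BoolFunc n) : ℝ :=
  if memRel f x.1 (D x) then 1 else -1

/-- Flip the truth table at `v`. -/
def flipAt {n : ℕ} (v : Fin n → ZMod 2) (f : BoolFunc n) : BoolFunc n :=
  f + Pi.single v 1

theorem zmod_flip (p q b : ZMod 2) : (p + 1 + q = b) ↔ ¬ (p + q = b) := by
  revert p q b; decide

theorem zmod_flip' (p q b : ZMod 2) : (p + (q + 1) = b) ↔ ¬ (p + q = b) := by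
  revert p q b; decide

theorem flipAt_invol {n : ℕ} (v : Fin n → ZMod 2) : Function.Involutive (flipAt v) := by
  intro f
  have h : (Pi.single v 1 + Pi.single v 1 : BoolFunc n) = 0 := by
    rw [← Pi.single_add]
    have : (1 + 1 : ZMod 2) = 0 := by decide
    rw [this, Pi.single_zero]
  rw [flipAt, flipAt, add_assoc, h, add_zero]

theorem outSign_flip_ne {n : ℕ}
    (D : {x : Fin n → ZMod 2 // x ≠ 0} → (Fin n → ZMod 2) × ZMod 2)
    (x : {x : Fin n → ZMod 2 // x ≠ 0}) (f : BoolFunc n) (v : Fin n → ZMod 2)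
    (h1 : (D x).1 ≠ v) (h2 : (D x).1 + x.1 ≠ v) :
    outSign D x (flipAt v f) = outSign D x f := by
  unfold outSign memRel flipAt
  simp only [Pi.add_apply, Pi.single_eq_of_ne h1, Pi.single_eq_of_ne h2, add_zero]

theorem outSign_flip_eq {n : ℕ}
    (D : {x : Fin n → ZMod 2 // x ≠ 0} → (Fin n → ZMod 2) × ZMod 2)
    (x : {x : Fin n → ZMod 2 // x ≠ 0}) (f : BoolFunc n) (v : Fin n → ZMod 2)
    (h : (D x).1 = v ∨ (D x).1 + x.1 = v) :
    outSign D x (flipAt v f) = - outSign D x f := by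
  have hx : (D x).1 + x.1 ≠ (D x).1 := by simpa using x.2
  unfold outSign memRel flipAt
  rcases h with h | h
  · rw [← h]
    simp only [Pi.add_apply, Pi.single_eq_of_ne hx, Pi.single_eq_same, add_zero, zmod_flip]
    split_ifs <;> simp_all
  · rw [← h]
    simp only [Pi.add_apply, Pi.single_eq_of_ne hx.symm, Pi.single_eq_same, add_zero, zmod_flip']
    split_ifs <;> simp_all

theorem outSign_le {n : ℕ}
    (D : {x : Fin n → ZMod 2 // x ≠ 0} → (Fin n → ZMod 2) × ZMod 2)
    (x : {x : Fin n → ZMod 2 // x ≠ 0}) (f : BoolFunc n) : outSign D x f ≤ 1 := by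
  unfold outSign; split_ifs <;> norm_num

/-- A forest-like family `T` with vertex set contained in `V`. -/
def ForestLike {n : ℕ}
    (D : {x : Fin n → ZMod 2 // x ≠ 0} → (Fin n → ZMod 2) × ZMod 2)
    (T : Finset {x : Fin n → ZMod 2 // x ≠ 0}) (V : Finset (Fin n → ZMod 2)) : Prop :=
  V.card ≤ 2 * T.card ∧ (∀ x ∈ T, (D x).1 ∈ V ∧ (D x).1 + x.1 ∈ V) ∧
    ∑ f : BoolFunc n, Real.exp ((1 / 4) * ∑ x ∈ T, outSign D x f)
      ≤ (2 : ℝ) ^ (2 ^ n) * Real.cosh (1 / 4) ^ T.card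

theorem card_boolFunc (n : ℕ) : Fintype.card (BoolFunc n) = 2 ^ (2 ^ n) := by
  simp [BoolFunc, ZMod.card]

theorem forestLike_extend {n : ℕ}
    (D : {x : Fin n → ZMod 2 // x ≠ 0} → (Fin n → ZMod 2) × ZMod 2)
    (T : Finset {x : Fin n → ZMod 2 // x ≠ 0}) (V : Finset (Fin n → ZMod 2))
    (h : ForestLike D T V) (x : {x : Fin n → ZMod 2 // x ≠ 0})
    (hx : ¬ ((D x).1 ∈ V ∧ (D x).1 + x.1 ∈ V)) :
    x ∉ T ∧ ForestLike D (insert x T) (insert (D x).1 (insert ((D x).1 + x.1) V)) := by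
  obtain ⟨h1, h2, h3⟩ := h
  have hxT : x ∉ T := fun hh => hx (h2 x hh)
  refine ⟨hxT, ?_, ?_, ?_⟩
  · rw [Finset.card_insert_of_notMem hxT]
    have a1 := Finset.card_insert_le (D x).1 (insert ((D x).1 + x.1) V)
    have a2 := Finset.card_insert_le ((D x).1 + x.1) V
    omega
  · intro z hz
    rcases Finset.mem_insert.1 hz with rfl | hz
    · simp
    · have := h2 z hz
      simp [this.1, this.2]
  · obtain ⟨v, hv, hvV⟩ : ∃ v, ((D x).1 = v ∨ (D x).1 + x.1 = v) ∧ v ∉ V := by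
      by_cases hh : (D x).1 ∈ V
      · exact ⟨_, Or.inr rfl, fun h' => hx ⟨hh, h'⟩⟩
      · exact ⟨_, Or.inl rfl, hh⟩
    have hT : ∀ f, ∑ z ∈ T, outSign D z (flipAt v f) = ∑ z ∈ T, outSign D z f := by
      intro f
      refine Finset.sum_congr rfl fun z hz => outSign_flip_ne D z f v ?_ ?_
      · rintro rfl; exact hvV (h2 z hz).1
      · rintro rfl; exact hvV (h2 z hz).2
    set F : BoolFunc n → ℝ := fun f => Real.exp ((1 / 4) * ∑ z ∈ T, outSign D z f) with hF
    have e1 : ∀ f, Real.exp ((1 / 4) * ∑ z ∈ insert x T, outSign D z f)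
        = F f * Real.exp ((1 / 4) * outSign D x f) := by
      intro f
      rw [Finset.sum_insert hxT, hF, ← Real.exp_add]
      congr 1; ring
    have e2 : ∑ f, F f * Real.exp ((1 / 4) * outSign D x f)
        = ∑ f, F f * Real.exp (-((1 / 4) * outSign D x f)) := by
      rw [← Equiv.sum_comp (Function.Involutive.toPerm _ (flipAt_invol v))]
      refine Finset.sum_congr rfl fun f _ => ?_
      simp only [Function.Involutive.coe_toPerm, hF, hT, outSign_flip_eq D x f v hv, mul_neg]
    have e3 : ∀ f, F f * Real.exp ((1 / 4) * outSign D x f)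
        + F f * Real.exp (-((1 / 4) * outSign D x f)) = 2 * Real.cosh (1 / 4) * F f := by
      intro f
      have : Real.cosh ((1 / 4) * outSign D x f) = Real.cosh (1 / 4) := by
        unfold outSign; split_ifs
        · rw [mul_one]
        · rw [mul_neg_one, Real.cosh_neg]
      rw [← this, Real.cosh_eq]; ring
    have e4 : 2 * ∑ f, F f * Real.exp ((1 / 4) * outSign D x f)
        = 2 * Real.cosh (1 / 4) * ∑ f, F f := by
      rw [two_mul]
      nth_rewrite 2 [e2]
      rw [← Finset.sum_add_distrib, Finset.mul_sum]
      exact Finset.sum_congr rfl fun f _ => e3 f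
    rw [Finset.sum_congr rfl fun f _ => e1 f, Finset.card_insert_of_notMem hxT, pow_succ]
    have := mul_le_mul_of_nonneg_left h3 (Real.cosh_pos (1 / 4)).le
    nlinarith

theorem key_lemma {n : ℕ}
    (D : {x : Fin n → ZMod 2 // x ≠ 0} → (Fin n → ZMod 2) × ZMod 2)
    (G : Finset {x : Fin n → ZMod 2 // x ≠ 0}) (A : Finset (BoolFunc n))
    (hG : ∀ x ∈ G, (A.card : ℝ) / 4 ≤ ∑ f ∈ A, outSign D x f) :
    ∃ k : ℕ, G.card ≤ (2 * k) ^ 2 ∧ (A.card : ℝ) * Real.exp (k / 32) ≤ (2 : ℝ) ^ (2 ^ n) := by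
  classical
  obtain ⟨T, hT, hmax⟩ := Finset.exists_max_image
    (G.powerset.filter fun T => ∃ V, ForestLike D T V) Finset.card
    ⟨∅, by
      simp only [Finset.mem_filter, Finset.mem_powerset, Finset.empty_subset, true_and]
      refine ⟨∅, by simp, by simp, ?_⟩
      simp [card_boolFunc]⟩
  simp only [Finset.mem_filter, Finset.mem_powerset] at hT hmax
  obtain ⟨hTG, V, hV⟩ := hT
  refine ⟨T.card, ?_, ?_⟩
  · have hin : ∀ x ∈ G, (D x).1 ∈ V ∧ (D x).1 + x.1 ∈ V := by
      intro x hx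
      by_contra hcon
      obtain ⟨hxT, hF⟩ := forestLike_extend D T V hV x hcon
      have := hmax (insert x T) ⟨Finset.insert_subset hx hTG, _, hF⟩
      rw [Finset.card_insert_of_notMem hxT] at this
      omega
    calc G.card ≤ (V ×ˢ V).card := by
          refine Finset.card_le_card_of_injOn (fun x => ((D x).1, (D x).1 + x.1)) ?_ ?_
          · intro x hx
            exact Finset.mem_coe.2 (Finset.mem_product.2 (hin x hx))
          · intro x _ z _ hxz
            simp only [Prod.mk.injEq] at hxz
            have h2 := hxz.2
            rw [hxz.1] at h2
            exact Subtype.ext (add_left_cancel h2)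
      _ = V.card ^ 2 := by rw [Finset.card_product, sq]
      _ ≤ _ := Nat.pow_le_pow_left hV.1 2
  · obtain ⟨_, _, h3⟩ := hV
    set k : ℝ := (T.card : ℝ) with hk
    have hA : (A.card : ℝ) * Real.exp (k / 16) ≤
        ∑ f ∈ A, Real.exp ((1 / 4) * ∑ x ∈ T, outSign D x f) := by
      have h1 : ∀ f ∈ A, Real.exp (k / 16) * (1 + ((1 / 4) * ∑ x ∈ T, outSign D x f - k / 16))
          ≤ Real.exp ((1 / 4) * ∑ x ∈ T, outSign D x f) := by
        intro f _
        have := Real.add_one_le_exp ((1 / 4) * ∑ x ∈ T, outSign D x f - k / 16)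
        calc _ ≤ Real.exp (k / 16) * Real.exp ((1 / 4) * ∑ x ∈ T, outSign D x f - k / 16) := by
              gcongr; linarith
          _ = _ := by rw [← Real.exp_add]; congr 1; ring
      refine le_trans ?_ (Finset.sum_le_sum h1)
      rw [← Finset.mul_sum, Finset.sum_add_distrib, Finset.sum_sub_distrib, ← Finset.mul_sum,
        Finset.sum_comm]
      have h2 : k * ((A.card : ℝ) / 4) ≤ ∑ x ∈ T, ∑ f ∈ A, outSign D x f := by
        have := Finset.card_nsmul_le_sum T (fun x => ∑ f ∈ A, outSign D x f) _
          (fun x hx => hG x (hTG hx))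
        simpa [nsmul_eq_mul] using this
      simp only [Finset.sum_const, nsmul_eq_mul, mul_one]
      rw [mul_comm]
      gcongr
      linarith
    have hB : ∑ f ∈ A, Real.exp ((1 / 4) * ∑ x ∈ T, outSign D x f) ≤
        (2 : ℝ) ^ (2 ^ n) * Real.exp (k / 32) := by
      refine le_trans (Finset.sum_le_univ_sum_of_nonneg fun f => (Real.exp_pos _).le)
        (h3.trans ?_)
      gcongr
      calc Real.cosh (1 / 4) ^ T.card ≤ Real.exp ((1 / 4) ^ 2 / 2) ^ T.card := by
            gcongr
            · exact Real.cosh_le_exp_half_sq _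
        _ = Real.exp (k / 32) := by rw [← Real.exp_nat_mul]; congr 1; rw [hk]; ring
    have hsplit : Real.exp (k / 16) = Real.exp (k / 32) * Real.exp (k / 32) := by
      rw [← Real.exp_add]; congr 1; ring
    have := hA.trans hB
    rw [hsplit, ← mul_assoc] at this
    exact le_of_mul_le_mul_right this (Real.exp_pos _)

theorem card_nonzero (n : ℕ) :
    (Fintype.card {x : Fin n → ZMod 2 // x ≠ 0} : ℝ) = (2 : ℝ) ^ n - 1 := by
  have h : Fintype.card {x : Fin n → ZMod 2 // x ≠ 0} = 2 ^ n - 1 := by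
    rw [Fintype.card_subtype_compl, Fintype.card_subtype_eq]
    simp [ZMod.card]
  rw [h, Nat.cast_sub Nat.one_le_two_pow]
  simp

/-- **Classical one-way lower bound for the XOR Hidden Matching problem.**
There is a constant `c > 0` such that for every `n ≥ 1` (with `N = 2^n`), every
deterministic one-way protocol `(enc, dec)` whose output `dec (enc f) x` lies in
`R_f(x)` for at least a `7/8`-fraction of the pairs `(f, x)` — uniform over truth tables
`f ∈ {0,1}^N` and nonzero `x ∈ 𝔽₂ⁿ` — must satisfy `m ≥ c·√N`. -/
theorem xor_hidden_matching_lower_bound :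
    ∃ c : ℝ, 0 < c ∧
      ∀ n : ℕ, 1 ≤ n → ∀ m : ℕ,
        ∀ enc : BoolFunc n → (Fin m → ZMod 2),
        ∀ dec : (Fin m → ZMod 2) → {x : Fin n → ZMod 2 // x ≠ 0} →
          (Fin n → ZMod 2) × ZMod 2,
        (7 / 8 : ℝ) * ((2 : ℝ) ^ (2 ^ n) * ((2 : ℝ) ^ n - 1)) ≤
          ((Finset.univ.filter
              fun p : BoolFunc n × {x : Fin n → ZMod 2 // x ≠ 0} =>
                memRel p.1 p.2.1 (dec (enc p.1) p.2)).card : ℝ) →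
        c * Real.sqrt ((2 : ℝ) ^ n) ≤ (m : ℝ) := by
  refine ⟨1 / 256, by norm_num, ?_⟩
  intro n hn m enc dec hyp
  classical
  set W : ℝ := (2 : ℝ) ^ (2 ^ n) with hW
  set X : ℝ := (2 : ℝ) ^ n - 1 with hX
  set M : ℝ := (2 : ℝ) ^ m with hM
  have hWpos : 0 < W := by positivity
  have hMpos : 0 < M := by positivity
  have hN2 : (2 : ℝ) ≤ 2 ^ n := by
    calc (2 : ℝ) = 2 ^ 1 := by norm_num
      _ ≤ 2 ^ n := pow_le_pow_right₀ (by norm_num) hn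
  have hXpos : 0 < X := by linarith
  set A : (Fin m → ZMod 2) → Finset (BoolFunc n) :=
    fun a => Finset.univ.filter fun f => enc f = a with hA
  have hcardF : (Fintype.card (BoolFunc n) : ℝ) = W := by
    rw [card_boolFunc]; push_cast; rfl
  have hcardM : (Fintype.card (Fin m → ZMod 2) : ℝ) = M := by
    simp [ZMod.card, hM]
  have hAsum : ∑ a, ((A a).card : ℝ) = W := by
    rw [← hcardF, ← Nat.cast_sum, ← Finset.card_univ,
      Finset.card_eq_sum_card_fiberwise (f := enc) (t := Finset.univ) (by simp)]
  -- total sign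
  have htot : 3 / 4 * (W * X) ≤ ∑ f : BoolFunc n, ∑ x, outSign (dec (enc f)) x f := by
    rw [← Fintype.sum_prod_type']
    have h1 : ∀ p : BoolFunc n × {x : Fin n → ZMod 2 // x ≠ 0},
        outSign (dec (enc p.1)) p.2 p.1
          = 2 * (if memRel p.1 p.2.1 (dec (enc p.1) p.2) then (1 : ℝ) else 0) - 1 := by
      intro p; unfold outSign; split_ifs <;> norm_num
    rw [Finset.sum_congr rfl fun p _ => h1 p, Finset.sum_sub_distrib, ← Finset.mul_sum,
      Finset.sum_boole]
    simp only [Finset.sum_const, nsmul_eq_mul, mul_one, Finset.card_univ, Fintype.card_prod,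
      Nat.cast_mul]
    rw [hcardF, card_nonzero]
    linarith
  have htot2 : ∑ f : BoolFunc n, ∑ x, outSign (dec (enc f)) x f
      = ∑ a, ∑ x, ∑ f ∈ A a, outSign (dec a) x f := by
    rw [← Finset.sum_fiberwise Finset.univ enc]
    refine Finset.sum_congr rfl fun a _ => ?_
    rw [Finset.sum_comm]
    refine Finset.sum_congr rfl fun x _ => Finset.sum_congr rfl fun f hf => ?_
    rw [(Finset.mem_filter.1 hf).2]
  obtain ⟨a, ha⟩ : ∃ a, 5 / 8 * ((A a).card * X) + W * X / (8 * M)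
      ≤ ∑ x, ∑ f ∈ A a, outSign (dec a) x f := by
    by_contra! hcon
    have := Finset.sum_lt_sum_of_nonempty Finset.univ_nonempty fun a _ => hcon a
    rw [← htot2, Finset.sum_add_distrib, ← Finset.mul_sum, ← Finset.sum_mul, hAsum,
      Finset.sum_const, nsmul_eq_mul, Finset.card_univ, hcardM] at this
    have e : M * (W * X / (8 * M)) = W * X / 8 := by field_simp
    rw [e] at this
    linarith
  have hub : ∀ x, ∑ f ∈ A a, outSign (dec a) x f ≤ (A a).card := by
    intro x
    have := Finset.sum_le_card_nsmul (A a) (fun f => outSign (dec a) x f) 1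
      (fun f _ => outSign_le _ _ _)
    simpa using this
  have hW8 : 0 < W * X / (8 * M) := by positivity
  have hAX : ∑ x, ∑ f ∈ A a, outSign (dec a) x f ≤ (A a).card * X := by
    calc _ ≤ ∑ x : {x : Fin n → ZMod 2 // x ≠ 0}, ((A a).card : ℝ) :=
          Finset.sum_le_sum fun x _ => hub x
      _ = _ := by
          rw [Finset.sum_const, nsmul_eq_mul, Finset.card_univ, card_nonzero, mul_comm]
  have hAlb : W ≤ 3 * M * (A a).card := by
    have h1 : W * X / (8 * M) ≤ 3 / 8 * ((A a).card * X) := by linarith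
    rw [div_le_iff₀ (by positivity)] at h1
    have h2 : W * X ≤ (3 * M * (A a).card) * X := by linarith
    exact le_of_mul_le_mul_right h2 hXpos
  have hApos : (0 : ℝ) < (A a).card := by
    by_contra hcon
    have : ((A a).card : ℝ) = 0 := le_antisymm (not_lt.1 hcon) (Nat.cast_nonneg _)
    rw [this] at hAlb
    linarith
  set G := Finset.univ.filter fun x : {x : Fin n → ZMod 2 // x ≠ 0} =>
    ((A a).card : ℝ) / 4 ≤ ∑ f ∈ A a, outSign (dec a) x f with hG
  have hGcard : X / 2 ≤ G.card := by
    have h1 : ∑ x, ∑ f ∈ A a, outSign (dec a) x f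
        ≤ ∑ x : {x : Fin n → ZMod 2 // x ≠ 0}, (((A a).card : ℝ) / 4
          + 3 / 4 * (A a).card * (if ((A a).card : ℝ) / 4 ≤ ∑ f ∈ A a, outSign (dec a) x f
            then (1 : ℝ) else 0)) := by
      refine Finset.sum_le_sum fun x _ => ?_
      split_ifs with h
      · linarith [hub x]
      · linarith
    rw [Finset.sum_add_distrib, ← Finset.mul_sum, Finset.sum_boole, Finset.sum_const,
      nsmul_eq_mul, Finset.card_univ, card_nonzero, ← hG] at h1
    have h2 : (A a).card * (X / 2) ≤ (A a).card * (G.card : ℝ) := by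
      rw [← hX] at h1
      linarith
    exact le_of_mul_le_mul_left h2 hApos
  obtain ⟨k, hk1, hk2⟩ := key_lemma (dec a) G (A a) fun x hx => (Finset.mem_filter.1 hx).2
  have hk1' : (G.card : ℝ) ≤ (2 * (k : ℝ)) ^ 2 := by exact_mod_cast hk1
  have hksqrt : Real.sqrt ((2 : ℝ) ^ n) ≤ 4 * k := by
    rw [Real.sqrt_le_left (by positivity)]
    nlinarith
  have hkm : (k : ℝ) / 32 ≤ 2 * m := by
    rw [← Real.exp_le_exp]
    rcases Nat.eq_zero_or_pos m with hm | hm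
    · subst hm
      have hAW : ((A a).card : ℝ) = W := by
        rw [← hcardF, ← Finset.card_univ]
        congr 2
        rw [hA]
        exact Finset.filter_true_of_mem fun f _ => Subsingleton.elim _ _
      rw [hAW] at hk2
      simp only [CharP.cast_eq_zero, mul_zero, Real.exp_zero]
      exact le_of_mul_le_mul_left (by linarith) hWpos
    · have h1 : Real.exp (k / 32) ≤ 3 * M := by
        refine le_of_mul_le_mul_left ?_ hApos
        linarith
      refine h1.trans ?_
      have h6 : (6 : ℝ) ≤ Real.exp 2 := by
        have e : Real.exp 2 = Real.exp 1 * Real.exp 1 := by rw [← Real.exp_add]; norm_num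
        have := Real.exp_one_gt_d9
        rw [e]; nlinarith
      calc 3 * M ≤ 3 ^ m * 2 ^ m := by
            rw [hM]
            gcongr
            exact le_self_pow₀ (by norm_num) hm.ne'
        _ = (6 : ℝ) ^ m := by rw [← mul_pow]; norm_num
        _ ≤ Real.exp 2 ^ m := by gcongr
        _ = Real.exp (2 * m) := by rw [← Real.exp_nat_mul]; congr 1; ring
  linarith
end
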